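/- arXiv:1909.04463 — 2 statements merged into one kernel-verified Lean document; each statement's English description precedes it below -/
import Mathlib

section
/- Let m ≥ 2 and let P_m be the path graph on m vertices. The S-labeling number of P_m, i.e., the minimum of SL_φ(P_m) over all bijective labelings φ of its vertices with {1, …, m}, equals (m−1)²/4 + (m−1)/2 if m is odd and m²/4 if m is even; equivalently, SL_{φ*}(P_m) = ⌊m²/4⌋. -/
open Finset

instance (m : ℕ) : DecidableRel (SimpleGraph.pathGraph m).Adj :=
  fun _ _ => decidable_of_iff _ SimpleGraph.pathGraph_adj.symm

/-- The S-labeling value of a labeling `φ` of the vertices of `G`: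
the sum over all edges of the minimum of the labels of the two endpoints. -/
def SLabel {V : Type*} [Fintype V] [DecidableEq V] (G : SimpleGraph V)
    [DecidableRel G.Adj] (φ : V → ℕ) : ℕ :=
  ∑ e ∈ G.edgeFinset, Sym2.lift ⟨fun u v => min (φ u) (φ v), fun _ _ => min_comm _ _⟩ e

/-- The S-labeling value of a path, as a sum over consecutive pairs of vertices. -/
theorem SLabel_pathGraph_succ (n : ℕ) (φ : Fin (n + 1) → ℕ) :
    SLabel (SimpleGraph.pathGraph (n + 1)) φ = ∑ i : Fin n, min (φ i.castSucc) (φ i.succ) := by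
  have hinj : Function.Injective fun i : Fin n ↦ s(i.castSucc, i.succ) := by
    intro i j h
    simp only [Sym2.eq_iff, Fin.ext_iff, Fin.val_castSucc, Fin.val_succ] at h
    ext
    omega
  have hedge : (SimpleGraph.pathGraph (n + 1)).edgeFinset =
      univ.map ⟨fun i : Fin n ↦ s(i.castSucc, i.succ), hinj⟩ := by
    ext e
    induction e with | _ u v
    simp only [SimpleGraph.mem_edgeFinset, SimpleGraph.mem_edgeSet, SimpleGraph.pathGraph_adj,
      mem_map, mem_univ, true_and, Function.Embedding.coeFn_mk, Sym2.eq_iff, Fin.ext_iff,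
      Fin.val_castSucc, Fin.val_succ]
    constructor
    · rintro (h | h)
      · exact ⟨⟨u, by omega⟩, Or.inl ⟨rfl, h⟩⟩
      · exact ⟨⟨v, by omega⟩, Or.inr ⟨rfl, h⟩⟩
    · rintro ⟨i, hi⟩
      omega
  rw [SLabel, hedge, sum_map]
  rfl

theorem sum_tsub_Icc_one {k m : ℕ} (hk : k ≤ m + 1) :
    2 * ∑ j ∈ Icc 1 m, (k - j) = k * (k - 1) := by
  have hrange : ∑ j ∈ range k, (k - 1 - j) = ∑ j ∈ Icc 1 m, (k - j) := by
    have hIco : ∑ j ∈ Ico 1 k, (k - j) = ∑ j ∈ Icc 1 m, (k - j) :=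
      sum_subset (fun j hj ↦ by simp only [mem_Ico, mem_Icc] at *; omega)
        (fun j hj hj' ↦ by simp only [mem_Ico, mem_Icc] at *; omega)
    rw [← hIco]
    rcases k with _ | k
    · simp
    · rw [sum_Ico_eq_sum_range, sum_range_succ]
      simp only [Nat.add_sub_cancel, Nat.sub_self, add_zero]
      exact sum_congr rfl fun j _ ↦ by omega
  rw [← hrange, sum_range_reflect (fun j ↦ j) k, mul_comm, sum_range_id_mul_two]

/-- Truncating the labels at `k` bounds the S-labeling value of a path from below. -/
theorem mul_le_SLabel_pathGraph_add {n k : ℕ} (hk : k ≤ n + 2) {φ : Fin (n + 1) → ℕ}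
    (hφ : Set.BijOn φ Set.univ (Set.Icc 1 (n + 1))) :
    n * k ≤ SLabel (SimpleGraph.pathGraph (n + 1)) φ + k * (k - 1) := by
  have hsum : ∑ i, (k - φ i) = ∑ j ∈ Icc 1 (n + 1), (k - j) :=
    sum_bij (fun i _ ↦ φ i) (fun i _ ↦ by simpa using hφ.mapsTo (Set.mem_univ i))
      (fun i _ j _ h ↦ hφ.injOn (Set.mem_univ i) (Set.mem_univ j) h)
      (fun j hj ↦ by simpa using hφ.surjOn (by simpa using hj)) (fun _ _ ↦ rfl)
  have hcast := Fin.sum_univ_castSucc fun i ↦ k - φ i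
  have hsucc := Fin.sum_univ_succ fun i ↦ k - φ i
  have hle : ∑ _i : Fin n, k ≤ ∑ i : Fin n,
      (min (φ i.castSucc) (φ i.succ) + ((k - φ i.castSucc) + (k - φ i.succ))) :=
    sum_le_sum fun i _ ↦ by omega
  rw [sum_add_distrib, sum_add_distrib, ← SLabel_pathGraph_succ, sum_const, card_univ,
    Fintype.card_fin, smul_eq_mul] at hle
  have htri := sum_tsub_Icc_one hk
  omega

theorem sum_range_half_add_one (n : ℕ) :
    ∑ i ∈ range n, (i / 2 + 1) = (n + 1) ^ 2 / 4 := by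
  induction n with
  | zero => simp
  | succ n ih =>
    rw [sum_range_succ, ih]
    obtain ⟨k, rfl | rfl⟩ := Nat.even_or_odd' n <;> ring_nf <;> omega

/-- The labeling of a path alternating between the largest and the smallest unused labels. -/
def zigzagLabel (m : ℕ) (i : Fin m) : ℕ :=
  if (i : ℕ) % 2 = 0 then m - i / 2 else i / 2 + 1

theorem bijOn_zigzagLabel (m : ℕ) : Set.BijOn (zigzagLabel m) Set.univ (Set.Icc 1 m) := by
  refine ⟨fun i _ ↦ ?_, fun i _ j _ h ↦ ?_, fun j hj ↦ ?_⟩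
  · simp only [zigzagLabel, Set.mem_Icc]
    split_ifs <;> omega
  · simp only [zigzagLabel] at h
    ext
    split_ifs at h <;> omega
  · simp only [Set.mem_Icc] at hj
    by_cases h : j ≤ m / 2
    · refine ⟨⟨2 * j - 1, by omega⟩, Set.mem_univ _, ?_⟩
      simp only [zigzagLabel]
      split_ifs <;> omega
    · refine ⟨⟨2 * (m - j), by omega⟩, Set.mem_univ _, ?_⟩
      simp only [zigzagLabel]
      split_ifs <;> omega

theorem SLabel_pathGraph_zigzagLabel (n : ℕ) :
    SLabel (SimpleGraph.pathGraph (n + 1)) (zigzagLabel (n + 1)) = (n + 1) ^ 2 / 4 := by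
  rw [SLabel_pathGraph_succ, ← sum_range_half_add_one, ← Fin.sum_univ_eq_sum_range]
  refine sum_congr rfl fun i _ ↦ ?_
  simp only [zigzagLabel, Fin.val_castSucc, Fin.val_succ]
  split_ifs <;> omega

theorem sq_div_four_le_SLabel_pathGraph {n : ℕ} {φ : Fin (n + 1) → ℕ}
    (hφ : Set.BijOn φ Set.univ (Set.Icc 1 (n + 1))) :
    (n + 1) ^ 2 / 4 ≤ SLabel (SimpleGraph.pathGraph (n + 1)) φ := by
  obtain ⟨k, rfl | rfl⟩ := Nat.even_or_odd' n
  · have h := mul_le_SLabel_pathGraph_add (k := k + 1) (by omega) hφ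
    rw [Nat.add_sub_cancel] at h
    ring_nf at h ⊢
    omega
  · have h := mul_le_SLabel_pathGraph_add (k := k + 1) (by omega) hφ
    rw [Nat.add_sub_cancel] at h
    ring_nf at h ⊢
    omega

theorem cast_sq_div_four (m : ℕ) :
    ((m ^ 2 / 4 : ℕ) : ℚ) =
      if Odd m then ((m : ℚ) - 1) ^ 2 / 4 + ((m : ℚ) - 1) / 2 else (m : ℚ) ^ 2 / 4 := by
  obtain ⟨k, rfl | rfl⟩ := Nat.even_or_odd' m
  · have h : (2 * k) ^ 2 / 4 = k ^ 2 := by ring_nf; omega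
    rw [h, if_neg (Nat.not_odd_iff_even.mpr (even_two_mul k))]
    push_cast
    ring
  · have h : (2 * k + 1) ^ 2 / 4 = k ^ 2 + k := by ring_nf; omega
    rw [h, if_pos (odd_two_mul_add_one k)]
    push_cast
    ring

/-- for `m ≥ 2`, the S-labeling number of the path graph `P_m`, i.e. the
minimum of `SL_φ(P_m)` over all bijective labelings `φ`, equals `(m-1)²/4 + (m-1)/2`
if `m` is odd and `m²/4` if `m` is even; equivalently it equals `⌊m²/4⌋ = m²/4`
(natural-number division). -/
theorem slabel_number_pathGraph (m : ℕ) (hm : 2 ≤ m) :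
    IsLeast {z : ℕ | ∃ φ : Fin m → ℕ, Set.BijOn φ Set.univ (Set.Icc 1 m) ∧
        SLabel (SimpleGraph.pathGraph m) φ = z} (m ^ 2 / 4) ∧
      ((m ^ 2 / 4 : ℕ) : ℚ) =
        if Odd m then ((m : ℚ) - 1) ^ 2 / 4 + ((m : ℚ) - 1) / 2 else (m : ℚ) ^ 2 / 4 := by
  refine ⟨?_, cast_sq_div_four m⟩
  obtain ⟨n, rfl⟩ : ∃ n, m = n + 1 := ⟨m - 1, by omega⟩
  refine ⟨⟨zigzagLabel (n + 1), bijOn_zigzagLabel _, SLabel_pathGraph_zigzagLabel n⟩, ?_⟩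
  rintro _ ⟨φ, hφ, rfl⟩
  exact sq_div_four_le_SLabel_pathGraph hφ
end

section
/- Let n ≥ 3 and let C_n be the cycle graph on n vertices v_1, …, v_n. There exists a bijective labeling φ of its vertices with {1, …, n} such that SL_φ(C_n) = n²/4 + n/2 if n is even, and SL_φ(C_n) = (n+1)²/4 if n is odd; such a labeling is obtained by starting at an arbitrary vertex and assigning the smallest labels 1, 2, …, ⌊n/2⌋ to every second vertex around the cycle, labeling the remaining vertices arbitrarily. -/
open Finset

/-- For `n ≥ 3`, a sum over the edges of `C_n` is the sum over `i` of the values at `{i, i + 1}`. -/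
theorem sum_edgeFinset_cycleGraph {M : Type*} [AddCommMonoid M] (n : ℕ) (f : Sym2 (Fin (n + 3)) → M) :
    ∑ e ∈ (SimpleGraph.cycleGraph (n + 3)).edgeFinset, f e = ∑ i : Fin (n + 3), f s(i, i + 1) := by
  symm
  refine Finset.sum_bij (fun i _ => s(i, i + 1)) ?_ ?_ ?_ fun _ _ => rfl
  · intro i _
    simp [SimpleGraph.cycleGraph_adj]
  · intro i _ j _ h
    rcases Sym2.eq_iff.mp h with ⟨h, -⟩ | ⟨h, h'⟩
    · exact h
    · have h2 : (1 + 1 : Fin (n + 3)) = 0 := by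
        rw [h, add_assoc] at h'
        simpa using h'
      simp [Fin.ext_iff, Fin.val_add, Nat.mod_eq_of_lt (show 2 < n + 3 by omega)] at h2
  · intro e he
    induction e using Sym2.ind with
    | _ u v =>
      rw [SimpleGraph.mem_edgeFinset, SimpleGraph.mem_edgeSet, SimpleGraph.cycleGraph_adj] at he
      rcases he with h | h
      · exact ⟨v, mem_univ _, by rw [← h, add_sub_cancel, Sym2.eq_swap]⟩
      · exact ⟨u, mem_univ _, by rw [← h, add_sub_cancel]⟩

theorem four_mul_sum_range_half_add_one (n : ℕ) :
    4 * ∑ i ∈ range n, (i / 2 + 1) = if Even n then n ^ 2 + 2 * n else (n + 1) ^ 2 := by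
  induction n with
  | zero => simp
  | succ n ih =>
    rw [sum_range_succ, mul_add, ih]
    rcases Nat.even_or_odd' n with ⟨k, rfl | rfl⟩
    · have h : 2 * k / 2 = k := by omega
      simp only [Nat.even_add_one, even_two_mul, h, if_true, not_true, if_false]
      ring
    · have h : (2 * k + 1) / 2 = k := by omega
      simp only [Nat.even_add_one, even_two_mul, h, if_true, not_true, if_false, not_false_iff]
      ring

/-- The labeling of `C_n` giving the labels `1, …, ⌊n/2⌋` to the odd positions in order, and the
remaining labels to the even positions in order. -/
def alternatingLabel (n i : ℕ) : ℕ :=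
  if i % 2 = 1 then i / 2 + 1 else n / 2 + i / 2 + 1

theorem bijOn_alternatingLabel (n : ℕ) :
    Set.BijOn (fun i : Fin n => alternatingLabel n i) Set.univ (Set.Icc 1 n) := by
  refine ⟨?_, ?_, ?_⟩
  · rintro ⟨i, hi⟩ -
    simp only [alternatingLabel, Set.mem_Icc]
    split_ifs <;> omega
  · rintro ⟨i, hi⟩ - ⟨j, hj⟩ - h
    simp only [alternatingLabel] at h
    rw [Fin.mk.injEq]
    split_ifs at h <;> omega
  · rintro y ⟨h1, h2⟩
    by_cases hy : y ≤ n / 2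
    · refine ⟨⟨2 * (y - 1) + 1, by omega⟩, Set.mem_univ _, ?_⟩
      simp only [alternatingLabel]
      split_ifs <;> omega
    · refine ⟨⟨2 * (y - n / 2 - 1), by omega⟩, Set.mem_univ _, ?_⟩
      simp only [alternatingLabel]
      split_ifs <;> omega

theorem min_alternatingLabel_add_one (n : ℕ) (i : Fin (n + 1)) :
    min (alternatingLabel (n + 1) i) (alternatingLabel (n + 1) (i + 1 : Fin (n + 1))) =
      (i : ℕ) / 2 + 1 := by
  have hi := i.isLt
  rw [Fin.val_add_one]
  simp only [alternatingLabel, Fin.ext_iff, Fin.val_last]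
  by_cases h : (i : ℕ) = n
  · simp only [h, if_true]
    split_ifs <;> first | contradiction | omega
  · simp only [h, if_false]
    split_ifs <;> omega

/-- for `n ≥ 3` there is a bijective labeling `φ` of the cycle graph `C_n`
with `SL_φ(C_n) = n²/4 + n/2` if `n` is even and `SL_φ(C_n) = (n+1)²/4` if `n` is odd. -/
theorem exists_labeling_cycleGraph (n : ℕ) (hn : 3 ≤ n) :
    ∃ φ : Fin n → ℕ, Set.BijOn φ Set.univ (Set.Icc 1 n) ∧
      (SLabel (SimpleGraph.cycleGraph n) φ : ℚ) =
        if Even n then (n : ℚ) ^ 2 / 4 + (n : ℚ) / 2 else ((n : ℚ) + 1) ^ 2 / 4 := by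
  obtain ⟨m, rfl⟩ := Nat.exists_eq_add_of_le' hn
  refine ⟨fun i => alternatingLabel (m + 3) i, bijOn_alternatingLabel _, ?_⟩
  have hS : SLabel (SimpleGraph.cycleGraph (m + 3)) (fun i => alternatingLabel (m + 3) i) =
      ∑ i ∈ range (m + 3), (i / 2 + 1) := by
    rw [SLabel, sum_edgeFinset_cycleGraph, ← Fin.sum_univ_eq_sum_range (fun i => i / 2 + 1)]
    exact sum_congr rfl fun i _ => min_alternatingLabel_add_one (m + 2) i
  have h4 := congrArg (Nat.cast (R := ℚ)) (four_mul_sum_range_half_add_one (m + 3))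
  rw [← hS] at h4
  split_ifs at h4 ⊢ <;> push_cast at h4 ⊢ <;> linarith
end
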